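/- Let X be an integral domain and let f, g : X → X satisfy g(x+y) − g(x) − g(y) = x·f(y) + y·f(x) for all x, y ∈ X. Then the even part of f satisfies 2·(f(x) + f(−x)) = 2·c·x² for all x ∈ X, where c = f(1) + f(−1). -/

import Mathlib

/-- The cocycle identity of the Cauchy difference of `g`, expressed through that of `f`. -/
theorem mul_cauchy_difference_eq {X : Type*} [CommRing X] {f g : X → X}
    (h : ∀ x y : X, g (x + y) - g x - g y = x * f y + y * f x) (x y z : X) :
    x * (f (y + z) - f y - f z) = z * (f (x + y) - f x - f y) := by
  have hxyz := h (x + y) z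
  rw [add_assoc] at hxyz
  linear_combination hxyz + h x y - h x (y + z) - h y z

theorem cauchy_difference_eq_mul {X : Type*} [CommRing X] {f g : X → X}
    (h : ∀ x y : X, g (x + y) - g x - g y = x * f y + y * f x) (x y : X) :
    f (x + y) - f x - f y = x * y * (f (1 + 1) - f 1 - f 1) := by
  have hxy := mul_cauchy_difference_eq h 1 x y
  have hx := mul_cauchy_difference_eq h 1 1 x
  linear_combination hxy + y * hx

theorem add_apply_neg_eq_mul_sq {X : Type*} [CommRing X] {f g : X → X}
    (h : ∀ x y : X, g (x + y) - g x - g y = x * f y + y * f x) (x : X) :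
    f x + f (-x) = (f 1 + f (-1)) * x ^ 2 := by
  have h0 := cauchy_difference_eq_mul h 0 0
  have h1 := cauchy_difference_eq_mul h 1 (-1)
  have hx := cauchy_difference_eq_mul h x (-x)
  rw [add_zero] at h0
  rw [add_neg_cancel] at h1 hx
  linear_combination x ^ 2 * h1 - hx + (x ^ 2 - 1) * h0

theorem stmt_17 {X : Type*} [CommRing X] [IsDomain X] (f g : X → X)
    (h : ∀ x y : X, g (x + y) - g x - g y = x * f y + y * f x) :
    ∀ x : X, 2 * (f x + f (-x)) = 2 * (f 1 + f (-1)) * x ^ 2 := by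
  intro x
  rw [add_apply_neg_eq_mul_sq h x, mul_assoc]
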